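/- (Sample size needed to claim bias, Equation 5) Fix ρ ∈ [0, 1), σ² ≥ 0, C > 0, γ > 0, and an observed sample bias δ̄ > 0. If the sample size n ≥ 1 satisfies n > ( 2σ² + (2C/(3γ)) δ̄ ) · ( −log((1 − ρ)/2) ) / δ̄², then the half-width t = ( B + sqrt( B² − 8 n σ² log((1 − ρ)/2) ) ) / (2n), with B = −(2C/(3γ)) log((1 − ρ)/2), satisfies t < δ̄; consequently 0 does not lie in the interval [δ̄ − t, δ̄ + t]. -/

import Mathlib

/-- Sample size needed to claim bias (Equation 5): for `ρ ∈ [0,1)`, `σ² ≥ 0`, `C > 0`,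
`γ > 0`, and an observed sample bias `δ̄ > 0`, if the sample size `n ≥ 1` satisfies
`n > (2σ² + (2C/(3γ)) δ̄) · (-log((1-ρ)/2)) / δ̄²`, then the half-width
`t = (B + √(B² - 8nσ² log((1-ρ)/2))) / (2n)` (with `B = -(2C/(3γ)) log((1-ρ)/2)`)
satisfies `t < δ̄`; consequently `0 ∉ [δ̄ - t, δ̄ + t]`. -/
theorem bbu_sample_size_for_bias_claim
    (ρ : ℝ) (hρ0 : 0 ≤ ρ) (hρ1 : ρ < 1)
    (σ2 : ℝ) (hσ2 : 0 ≤ σ2)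
    (C γ : ℝ) (hC : 0 < C) (hγ : 0 < γ)
    (δbar : ℝ) (hδbar : 0 < δbar)
    (n : ℕ) (hn : 1 ≤ n)
    (hn_large : (2 * σ2 + (2 * C / (3 * γ)) * δbar) * (-Real.log ((1 - ρ) / 2)) / δbar ^ 2
      < (n : ℝ))
    (B t : ℝ)
    (hB : B = -(2 * C / (3 * γ)) * Real.log ((1 - ρ) / 2))
    (ht : t = (B + Real.sqrt (B ^ 2 - 8 * n * σ2 * Real.log ((1 - ρ) / 2))) / (2 * n)) :
    t < δbar ∧ (0 : ℝ) ∉ Set.Icc (δbar - t) (δbar + t) := by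
  have hlog : Real.log ((1 - ρ) / 2) < 0 := Real.log_neg (by linarith) (by linarith)
  set ℓ := Real.log ((1 - ρ) / 2)
  have hn0 : (0 : ℝ) < n := by exact_mod_cast hn
  have hB0 : 0 < B := by
    rw [hB, neg_mul, ← mul_neg]
    exact mul_pos (by positivity) (neg_pos.mpr hlog)
  have hkey : 2 * σ2 * (-ℓ) + B * δbar < n * δbar ^ 2 := by
    rw [div_lt_iff₀ (by positivity)] at hn_large
    rw [hB]
    linarith
  have hσℓ : 0 ≤ σ2 * (-ℓ) := mul_nonneg hσ2 (neg_nonneg.mpr hlog.le)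
  have hBn : B < n * δbar := by
    refine lt_of_mul_lt_mul_right ?_ hδbar.le
    linarith
  have hsqrt : Real.sqrt (B ^ 2 - 8 * n * σ2 * ℓ) < 2 * n * δbar - B := by
    rw [Real.sqrt_lt' (by linarith)]
    linarith [mul_lt_mul_of_pos_left hkey hn0]
  have htδ : t < δbar := by
    rw [ht, div_lt_iff₀ (by positivity)]
    linarith
  exact ⟨htδ, fun h => by linarith [h.1]⟩
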